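/- The Hankel determinant of the Carlitz q-Euler numbers satisfies det_{0≤i,j≤n}(ε_{i+j}) = (−1)^{binom(n+1,2)} q^{(1/4)·binom(2n+2,3)} / (1−q)^{n(n+1)} · Π_{k=1}^n (q^2;q^2)_k (q^2;q^2)_k / ((−q;q^2)_k (−q^2;q^2)_k (−q^2;q^2)_k (−q^3;q^2)_k). -/

import Mathlib

open Finset

noncomputable def q : RatFunc ℚ := RatFunc.X

/-- q-Pochhammer `(A;Q)_n`. -/
noncomputable def qPoch (Q A : RatFunc ℚ) (n : ℕ) : RatFunc ℚ :=
  ∏ j ∈ Finset.range n, (1 - A * Q ^ j)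

open Polynomial in
/-- The linear functional on polynomials whose moments are the given sequence. -/
noncomputable def momentFunctional {K : Type*} [Field K] (ε : ℕ → K) : K[X] →ₗ[K] K :=
  Polynomial.lsum fun k => ε k • LinearMap.id

section Moments

open Polynomial

variable {K : Type*} [Field K]

lemma momentFunctional_monomial (ε : ℕ → K) (k : ℕ) (c : K) :
    momentFunctional ε (monomial k c) = c * ε k := by
  simp [momentFunctional, Polynomial.lsum_apply, Polynomial.sum_monomial_index, mul_comm]

lemma momentFunctional_C_mul_X_pow (ε : ℕ → K) (k : ℕ) (c : K) :
    momentFunctional ε (C c * X ^ k) = c * ε k := by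
  rw [C_mul_X_pow_eq_monomial, momentFunctional_monomial]

lemma momentFunctional_mul (ε : ℕ → K) {n : ℕ} {p r : K[X]} (hp : p.natDegree < n)
    (hr : r.natDegree < n) :
    momentFunctional ε (p * r) =
      ∑ k ∈ range n, ∑ l ∈ range n, p.coeff k * ε (k + l) * r.coeff l := by
  conv_lhs => rw [p.as_sum_range' n hp, r.as_sum_range' n hr]
  simp only [sum_mul_sum, map_sum, monomial_mul_monomial, momentFunctional_monomial]
  exact sum_congr rfl fun k _ => sum_congr rfl fun l _ => by ring

/-- The Carlitz recurrence, extended from monomials to all polynomials. -/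
lemma momentFunctional_comp (ε : ℕ → K) (t : K) (h0 : ε 0 = 1)
    (hrec : ∀ n : ℕ, 1 ≤ n →
      (∑ k ∈ range (n + 1), (n.choose k : K) * t ^ (k + 1) * ε k) + ε n = 0) (p : K[X]) :
    t * momentFunctional ε (p.comp (1 + C t * X)) + momentFunctional ε p =
      (1 + t) * p.eval 0 := by
  induction p using Polynomial.induction_on' with
  | add p r hp hr =>
    simp only [add_comp, map_add, eval_add]
    linear_combination hp + hr
  | monomial n c =>
    have hcomp : (monomial n c).comp (1 + C t * X) =
        ∑ k ∈ range (n + 1), C (c * (n.choose k : K) * t ^ k) * X ^ k := by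
      rw [monomial_comp, add_comm, add_pow, mul_sum]
      refine sum_congr rfl fun k _ => ?_
      simp only [one_pow, mul_one, mul_pow, map_mul, map_pow, map_natCast]
      ring
    rw [hcomp, map_sum, momentFunctional_monomial]
    simp only [momentFunctional_C_mul_X_pow]
    rcases Nat.eq_zero_or_pos n with rfl | hn
    · simp [h0]
      ring
    · have h := hrec n hn
      have hz : (monomial n c).eval 0 = 0 := by simp [eval_monomial, hn.ne']
      rw [hz, mul_zero, ← mul_zero c, ← h, mul_add, mul_sum, mul_sum]
      congr 1
      exact sum_congr rfl fun k _ => by ring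

lemma momentFunctional_pow (ε : ℕ → K) (t : K) (h0 : ε 0 = 1)
    (hrec : ∀ n : ℕ, 1 ≤ n →
      (∑ k ∈ range (n + 1), (n.choose k : K) * t ^ (k + 1) * ε k) + ε n = 0) (n : ℕ)
    (hn : 1 + t ^ (n + 1) ≠ 0) :
    momentFunctional ε ((1 + C (t - 1) * X) ^ n) = (1 + t) * (1 + t ^ (n + 1))⁻¹ := by
  have h := momentFunctional_comp ε t h0 hrec ((1 + C (t - 1) * X) ^ n)
  have hcomp : ((1 + C (t - 1) * X) ^ n).comp (1 + C t * X) =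
      t ^ n • (1 + C (t - 1) * X) ^ n := by
    rw [smul_eq_C_mul, C_pow, ← mul_pow, pow_comp]
    congr 1
    simp only [add_comp, one_comp, mul_comp, C_comp, X_comp]
    rw [map_sub, map_one]
    ring
  rw [hcomp, map_smul, smul_eq_mul] at h
  simp only [eval_pow, eval_add, eval_one, eval_mul, eval_X, mul_zero, add_zero, one_pow] at h
  rw [eq_mul_inv_iff_mul_eq₀ hn]
  linear_combination h

/-- Changing the variable from `x` to `1 + s x` scales a Hankel determinant. -/
lemma det_momentFunctional_pow (ε : ℕ → K) (s : K) (n : ℕ) :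
    Matrix.det (Matrix.of fun i j : Fin (n + 1) =>
        momentFunctional ε ((1 + C s * X) ^ ((i : ℕ) + (j : ℕ)))) =
      s ^ (n * (n + 1)) *
        Matrix.det (Matrix.of fun i j : Fin (n + 1) => ε ((i : ℕ) + (j : ℕ))) := by
  have hlin : (1 + C s * X : K[X]).natDegree ≤ 1 := by
    rw [add_comm, ← C_1]
    exact natDegree_linear_le
  have hdeg : ∀ i : ℕ, ((1 + C s * X : K[X]) ^ i).natDegree ≤ i := fun i => by
    simpa using natDegree_pow_le_of_le i hlin
  have hcoeff : ∀ i : ℕ, ((1 + C s * X : K[X]) ^ i).coeff i = s ^ i := fun i => by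
    have h := coeff_pow_of_natDegree_le (m := i) hlin
    simpa [coeff_one] using h
  let B : Matrix (Fin (n + 1)) (Fin (n + 1)) K :=
    Matrix.of fun i k => ((1 + C s * X : K[X]) ^ (i : ℕ)).coeff k
  have hB : B.det = s ^ (∑ i ∈ range (n + 1), i) := by
    have hlow : B.IsLowerTriangular := by
      intro i j hij
      exact coeff_eq_zero_of_natDegree_lt ((hdeg i).trans_lt hij)
    rw [Matrix.det_of_isLowerTriangular B hlow, ← prod_pow_eq_pow_sum,
      ← Fin.prod_univ_eq_prod_range (fun i => s ^ i)]
    exact prod_congr rfl fun i _ => hcoeff i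
  have hfac : (Matrix.of fun i j : Fin (n + 1) =>
        momentFunctional ε ((1 + C s * X) ^ ((i : ℕ) + (j : ℕ)))) =
      B * (Matrix.of fun i j : Fin (n + 1) => ε ((i : ℕ) + (j : ℕ))) * B.transpose := by
    ext i j
    rw [Matrix.of_apply, pow_add, momentFunctional_mul ε ((hdeg i).trans_lt i.2)
      ((hdeg j).trans_lt j.2), sum_comm]
    simp only [Matrix.mul_apply, Matrix.transpose_apply, Matrix.of_apply, B, ← sum_mul,
      ← Fin.sum_univ_eq_sum_range]
  rw [hfac, Matrix.det_mul, Matrix.det_mul, Matrix.det_transpose, hB]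
  have hexp : n * (n + 1) = (∑ i ∈ range (n + 1), i) * 2 := by
    rw [sum_range_id_mul_two, Nat.add_sub_cancel, mul_comm]
  rw [hexp, mul_two, pow_add]
  ring

end Moments

section Cauchy

variable {K : Type*} [Field K]

/-- One elimination step for the Cauchy-type matrix `1 / (1 + a i * b j)`. -/
lemma det_cauchy_succ (a b : ℕ → K) (n : ℕ) (h : ∀ i j, 1 + a i * b j ≠ 0) :
    Matrix.det (Matrix.of fun i j : Fin (n + 1) => (1 + a i * b j)⁻¹) =
      (1 + a n * b n)⁻¹ * (∏ i ∈ range n, ((a n - a i) * (1 + a i * b n)⁻¹)) *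
        (∏ i ∈ range n, ((b i - b n) * (1 + a n * b i)⁻¹)) *
          Matrix.det (Matrix.of fun i j : Fin n => (1 + a i * b j)⁻¹) := by
  set A : Matrix (Fin (n + 1)) (Fin (n + 1)) K := Matrix.of fun i j => (1 + a i * b j)⁻¹
  let c : Fin (n + 1) → K := fun i =>
    if i = Fin.last n then 0 else (1 + a i * b n)⁻¹ * (1 + a n * b n)
  let B : Matrix (Fin (n + 1)) (Fin (n + 1)) K := Matrix.of fun i j =>
    A i j - c i * A (Fin.last n) j
  have hAB : A.det = B.det :=
    Matrix.det_eq_of_forall_row_eq_smul_add_const c (Fin.last n) (by simp [c])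
      fun i j => by simp [B, c]
  have hcol : ∀ i : Fin n, B i.castSucc (Fin.last n) = 0 := fun i => by
    have h1 := h i n
    have h2 := h n n
    have h2' : 1 + b n * a n ≠ 0 := by rwa [mul_comm]
    simp only [B, A, c, Matrix.of_apply, Fin.castSucc_ne_last, if_false, Fin.val_castSucc,
      Fin.val_last]
    field_simp
    ring
  rw [hAB, Matrix.det_succ_column B (Fin.last n), Fin.sum_univ_castSucc]
  simp only [hcol, mul_zero, zero_mul, sum_const_zero, zero_add]
  have hsub : B.submatrix (Fin.last n).succAbove (Fin.last n).succAbove =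
      Matrix.of fun i j : Fin n => ((a n - a i) * (1 + a i * b n)⁻¹) *
        (Matrix.of fun i j : Fin n => ((b j - b n) * (1 + a n * b j)⁻¹) *
          (Matrix.of fun i j : Fin n => (1 + a i * b j)⁻¹) i j) i j := by
    ext i j
    have h1 := h i n
    have h2 := h n n
    have h2' : 1 + b n * a n ≠ 0 := by rwa [mul_comm]
    have h3 := h n j
    have h3' : 1 + b j * a n ≠ 0 := by rwa [mul_comm]
    have h4 := h i j
    simp only [B, A, c, Matrix.of_apply, Matrix.submatrix_apply, Fin.succAbove_last,
      Fin.castSucc_ne_last, if_false, Fin.val_castSucc, Fin.val_last]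
    field_simp
    ring
  rw [hsub, Matrix.det_mul_column, Matrix.det_mul_row,
    Fin.prod_univ_eq_prod_range (fun i => (a n - a i) * (1 + a i * b n)⁻¹),
    Fin.prod_univ_eq_prod_range (fun i => (b i - b n) * (1 + a n * b i)⁻¹)]
  simp [B, A, c, ← two_mul]
  ring

end Cauchy

section QIdentities

lemma one_sub_q_ne_zero : 1 - q ≠ 0 := by
  have h : (1 - q : RatFunc ℚ) = algebraMap (Polynomial ℚ) (RatFunc ℚ) (1 - Polynomial.X) := by
    simp [q]
  rw [h]
  refine RatFunc.algebraMap_ne_zero fun h0 => ?_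
  simpa using congrArg (Polynomial.eval 0) h0

lemma one_add_q_pow_ne_zero (k : ℕ) : 1 + q ^ k ≠ 0 := by
  have h : (1 + q ^ k : RatFunc ℚ) =
      algebraMap (Polynomial ℚ) (RatFunc ℚ) (1 + Polynomial.X ^ k) := by
    simp [q]
  rw [h]
  refine RatFunc.algebraMap_ne_zero fun h0 => ?_
  have := congrArg (Polynomial.eval 1) h0
  norm_num at this

lemma qPoch_succ (Q A : RatFunc ℚ) (n : ℕ) : qPoch Q A (n + 1) = qPoch Q A n * (1 - A * Q ^ n) :=
  prod_range_succ _ _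

/-- `(q^2;q^2)_n = (q;q)_n (-q;q)_n`. -/
lemma qPoch_sq_sq (n : ℕ) :
    qPoch (q ^ 2) (q ^ 2) n =
      (∏ i ∈ range n, (1 - q ^ (i + 1))) * ∏ i ∈ range n, (1 + q ^ (i + 1)) := by
  rw [qPoch, ← prod_mul_distrib]
  exact prod_congr rfl fun i _ => by ring

/-- `(-q;q^2)_n (-q^2;q^2)_n = (-q;q)_{2n}`, split at index `n`. -/
lemma qPoch_neg_mul_qPoch_neg_sq (n : ℕ) :
    qPoch (q ^ 2) (-q) n * qPoch (q ^ 2) (-q ^ 2) n =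
      (∏ i ∈ range n, (1 + q ^ (i + 1))) * ∏ i ∈ range n, (1 + q ^ (n + i + 1)) := by
  rw [← prod_range_add (fun i => 1 + q ^ (i + 1)), ← two_mul]
  induction n with
  | zero => simp [qPoch]
  | succ n ih =>
    rw [qPoch_succ, qPoch_succ, show 2 * (n + 1) = 2 * n + 1 + 1 by ring, prod_range_succ,
      prod_range_succ, ← ih]
    ring

/-- `(1 + q) (-q^3;q^2)_n = (-q;q^2)_n (1 + q^(2n+1))`. -/
lemma one_add_mul_qPoch_neg_cube (n : ℕ) :
    (1 + q) * qPoch (q ^ 2) (-q ^ 3) n = qPoch (q ^ 2) (-q) n * (1 + q ^ (2 * n + 1)) := by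
  induction n with
  | zero => simp [qPoch]
  | succ n ih =>
    rw [qPoch_succ, qPoch_succ, ← mul_assoc, ih]
    ring

lemma prod_q_pow_sub (n : ℕ) :
    (∏ i ∈ range n, (q ^ n - q ^ i)) * (∏ i ∈ range n, (q ^ (i + 1) - q ^ (n + 1))) =
      (-1) ^ n * q ^ (n ^ 2) * (∏ i ∈ range n, (1 - q ^ (i + 1))) ^ 2 := by
  have hodd : ∏ i ∈ range n, q ^ (2 * i + 1) = q ^ (n ^ 2) := by
    rw [prod_pow_eq_pow_sum]
    congr 1
    induction n with
    | zero => rfl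
    | succ n ih => rw [sum_range_succ, ih]; ring
  have hrefl : ∏ i ∈ range n, (1 - q ^ (i + 1)) = ∏ i ∈ range n, (1 - q ^ (n - i)) := by
    rw [← prod_range_reflect]
    refine prod_congr rfl fun i hi => ?_
    have := mem_range.1 hi
    rw [show n - 1 - i + 1 = n - i by omega]
  have hneg : ((-1) ^ n : RatFunc ℚ) = ∏ _i ∈ range n, (-1) := by simp
  rw [hrefl, ← hodd, hneg, ← prod_pow, ← prod_mul_distrib, ← prod_mul_distrib,
    ← prod_mul_distrib]
  refine prod_congr rfl fun i hi => ?_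
  have h : q ^ n = q ^ i * q ^ (n - i) := by
    rw [← pow_add, Nat.add_sub_cancel' (mem_range.1 hi).le]
  rw [pow_succ q n, h]
  ring

lemma choose_three_div_four_succ (n : ℕ) :
    (2 * (n + 1) + 2).choose 3 / 4 = (2 * n + 2).choose 3 / 4 + (n + 1) ^ 2 := by
  have h : (2 * (n + 1) + 2).choose 3 = (2 * n + 2).choose 3 + (n + 1) ^ 2 * 4 := by
    have h2 := Nat.add_one_mul_choose_eq (2 * n + 1) 1
    rw [Nat.choose_one_right] at h2
    rw [show 2 * (n + 1) + 2 = 2 * n + 2 + 1 + 1 by ring, Nat.choose_succ_succ' _ 2,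
      Nat.choose_succ_succ' _ 2, Nat.choose_succ_succ' _ 1, Nat.choose_one_right]
    linarith
  rw [h, Nat.add_mul_div_right _ _ (by norm_num)]

/-- The ratio of consecutive Hankel determinants of the moments `(1 + q) / (1 + q^(k+1))`. -/
lemma cauchy_pivot (m : ℕ) :
    (1 + q) * ((1 + q ^ m * q ^ (m + 1))⁻¹ *
        (∏ i ∈ range m, ((q ^ m - q ^ i) * (1 + q ^ i * q ^ (m + 1))⁻¹)) *
        (∏ i ∈ range m, ((q ^ (i + 1) - q ^ (m + 1)) * (1 + q ^ m * q ^ (i + 1))⁻¹))) =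
    (-1) ^ m * q ^ (m ^ 2) * (qPoch (q ^ 2) (q ^ 2) m * qPoch (q ^ 2) (q ^ 2) m /
      (qPoch (q ^ 2) (-q) m * qPoch (q ^ 2) (-q ^ 2) m * qPoch (q ^ 2) (-q ^ 2) m *
        qPoch (q ^ 2) (-q ^ 3) m)) := by
  have hq : 1 + q ≠ 0 := by simpa using one_add_q_pow_ne_zero 1
  have htop : 1 + q ^ (2 * m + 1) ≠ 0 := one_add_q_pow_ne_zero _
  have hlow : ∏ i ∈ range m, (1 + q ^ (i + 1)) ≠ 0 :=
    prod_ne_zero_iff.2 fun i _ => one_add_q_pow_ne_zero _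
  have hhigh : ∏ i ∈ range m, (1 + q ^ (m + i + 1)) ≠ 0 :=
    prod_ne_zero_iff.2 fun i _ => one_add_q_pow_ne_zero _
  have h1 : ∏ i ∈ range m, (1 + q ^ i * q ^ (m + 1)) =
      ∏ i ∈ range m, (1 + q ^ (m + i + 1)) := prod_congr rfl fun i _ => by ring
  have h2 : ∏ i ∈ range m, (1 + q ^ m * q ^ (i + 1)) =
      ∏ i ∈ range m, (1 + q ^ (m + i + 1)) := prod_congr rfl fun i _ => by ring
  have h3 : 1 + q ^ m * q ^ (m + 1) = 1 + q ^ (2 * m + 1) := by ring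
  have hcube : qPoch (q ^ 2) (-q ^ 3) m =
      qPoch (q ^ 2) (-q) m * (1 + q ^ (2 * m + 1)) / (1 + q) := by
    rw [← one_add_mul_qPoch_neg_cube, mul_div_cancel_left₀ _ hq]
  have hden : qPoch (q ^ 2) (-q) m * qPoch (q ^ 2) (-q ^ 2) m * qPoch (q ^ 2) (-q ^ 2) m *
      qPoch (q ^ 2) (-q ^ 3) m =
      (qPoch (q ^ 2) (-q) m * qPoch (q ^ 2) (-q ^ 2) m) ^ 2 *
        (1 + q ^ (2 * m + 1)) / (1 + q) := by
    rw [hcube]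
    ring
  rw [prod_mul_distrib, prod_mul_distrib, prod_inv_distrib, prod_inv_distrib, h1, h2, h3, hden,
    qPoch_neg_mul_qPoch_neg_sq, qPoch_sq_sq]
  have hsub := prod_q_pow_sub m
  generalize (∏ i ∈ range m, (q ^ m - q ^ i)) = u at *
  generalize (∏ i ∈ range m, (q ^ (i + 1) - q ^ (m + 1))) = v at *
  generalize (∏ i ∈ range m, (1 + q ^ (m + i + 1))) = x at *
  generalize (∏ i ∈ range m, (1 + q ^ (i + 1))) = y at *
  generalize (∏ i ∈ range m, (1 - q ^ (i + 1))) = z at *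
  generalize 1 + q ^ (2 * m + 1) = w at *
  generalize 1 + q = r at *
  calc _ = r * w⁻¹ * (x⁻¹) ^ 2 * (u * v) := by ring
    _ = _ := by
      rw [hsub]
      field_simp

/-- The Hankel determinant of the moments `(1 + q) / (1 + q^(m+1))`. -/
lemma det_one_add_q_pow (n : ℕ) :
    Matrix.det (Matrix.of fun i j : Fin (n + 1) =>
        (1 + q) * (1 + q ^ ((i : ℕ) + (j : ℕ) + 1))⁻¹) =
      (-1) ^ ((n + 1).choose 2) * q ^ ((2 * n + 2).choose 3 / 4) *
        ∏ k ∈ Icc 1 n,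
          qPoch (q ^ 2) (q ^ 2) k * qPoch (q ^ 2) (q ^ 2) k /
            (qPoch (q ^ 2) (-q) k * qPoch (q ^ 2) (-q ^ 2) k * qPoch (q ^ 2) (-q ^ 2) k *
              qPoch (q ^ 2) (-q ^ 3) k) := by
  have hmat : ∀ m : ℕ, Matrix.det (Matrix.of fun i j : Fin m =>
        (1 + q) * (1 + q ^ ((i : ℕ) + (j : ℕ) + 1))⁻¹) =
      (1 + q) ^ m *
        Matrix.det (Matrix.of fun i j : Fin m => (1 + q ^ (i : ℕ) * q ^ ((j : ℕ) + 1))⁻¹) := by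
    intro m
    have h := Matrix.det_smul
      (Matrix.of fun i j : Fin m => (1 + q ^ (i : ℕ) * q ^ ((j : ℕ) + 1))⁻¹) (1 + q)
    rw [Fintype.card_fin] at h
    rw [← h]
    congr 1
    ext i j
    simp [← pow_add, add_assoc]
  have hne : ∀ i j : ℕ, 1 + q ^ i * q ^ (j + 1) ≠ 0 := fun i j => by
    rw [← pow_add]
    exact one_add_q_pow_ne_zero _
  induction n with
  | zero =>
    have h : 1 + q ≠ 0 := by simpa using one_add_q_pow_ne_zero 1
    simp [h]
  | succ n ih =>
    have hcomm : ∀ w x y z : RatFunc ℚ, w * x * (y * z) = w * z * (x * y) :=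
      fun w x y z => by ring
    rw [hmat] at ih ⊢
    rw [det_cauchy_succ (fun i => q ^ i) (fun j => q ^ (j + 1)) (n + 1) hne, pow_succ (1 + q),
      prod_Icc_succ_top (by omega), choose_three_div_four_succ, pow_add q _ ((n + 1) ^ 2),
      Nat.choose_succ_succ (n + 1) 1, Nat.choose_one_right, pow_add (-1 : RatFunc ℚ),
      hcomm, ih, cauchy_pivot]
    ring

end QIdentities

theorem hankel_qEuler (ε : ℕ → RatFunc ℚ) (hε0 : ε 0 = 1)
    (hεrec : ∀ n : ℕ, 1 ≤ n →
      (∑ k ∈ Finset.range (n + 1), (n.choose k : RatFunc ℚ) * q ^ (k + 1) * ε k) + ε n = 0) :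
    ∀ n : ℕ,
      Matrix.det (Matrix.of fun i j : Fin (n + 1) => ε ((i : ℕ) + (j : ℕ))) =
        (-1) ^ ((n + 1).choose 2) * q ^ ((2 * n + 2).choose 3 / 4) / (1 - q) ^ (n * (n + 1)) *
          ∏ k ∈ Finset.Icc 1 n,
            qPoch (q ^ 2) (q ^ 2) k * qPoch (q ^ 2) (q ^ 2) k /
              (qPoch (q ^ 2) (-q) k * qPoch (q ^ 2) (-q ^ 2) k * qPoch (q ^ 2) (-q ^ 2) k *
                qPoch (q ^ 2) (-q ^ 3) k) := by
  intro n
  have h := det_momentFunctional_pow ε (q - 1) n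
  simp only [momentFunctional_pow ε q hε0 hεrec _ (one_add_q_pow_ne_zero _)] at h
  rw [det_one_add_q_pow] at h
  have heven : (q - 1) ^ (n * (n + 1)) = (1 - q) ^ (n * (n + 1)) := by
    rw [← neg_sub, (Nat.even_mul_succ_self n).neg_pow]
  rw [heven] at h
  have hq : (1 - q) ^ (n * (n + 1)) ≠ 0 := pow_ne_zero _ one_sub_q_ne_zero
  rw [div_mul_eq_mul_div, eq_div_iff hq, h, mul_comm]
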